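/- arXiv:2409.06922 — 7 statements merged into one kernel-verified Lean document; each statement's English description precedes it below -/
import Mathlib

section
/- Let (a,b) ⊆ ℝ, let p, q, r : (a,b) → ℝ, let û : (a,b) → ℝ be everywhere positive, and let z ∈ ℂ. Assume that û and p·û′ are differentiable on (a,b), that y : (a,b) → ℂ and p·y′ are differentiable on (a,b), and that y satisfies −(p(x) y′(x))′ + q(x) y(x) = z r(x) y(x) for all x ∈ (a,b). Define P(x) = û(x)² p(x), R(x) = û(x)² r(x), and Q(x) = û(x)·(−(p(x) û′(x))′ + q(x) û(x)). Then the function v = y/û satisfies −(P(x) v′(x))′ + Q(x) v(x) = z R(x) v(x) for all x ∈ (a,b). -/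
/-- Lemma 3.2 of the paper (regularization of a quasi-regular Sturm–Liouville problem):
if `y` solves `−(p y′)′ + q y = z r y` on `(a,b)` and `û > 0` with `û`, `p û′`
differentiable, then `v = y/û` solves `−(P v′)′ + Q v = z R v` with `P = û² p`,
`R = û² r`, `Q = û (−(p û′)′ + q û)`. -/
theorem regularized_sturm_liouville_solution
    (a b : ℝ) (p q r uh : ℝ → ℝ) (uh' puh' : ℝ → ℝ) (y y' py' : ℝ → ℂ) (z : ℂ)
    (huhpos : ∀ x ∈ Set.Ioo a b, 0 < uh x)
    (huh : ∀ x ∈ Set.Ioo a b, HasDerivAt uh (uh' x) x)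
    (hpuh : ∀ x ∈ Set.Ioo a b, HasDerivAt (fun t => p t * uh' t) (puh' x) x)
    (hy : ∀ x ∈ Set.Ioo a b, HasDerivAt y (y' x) x)
    (hpy : ∀ x ∈ Set.Ioo a b, HasDerivAt (fun t => (p t : ℂ) * y' t) (py' x) x)
    (heq : ∀ x ∈ Set.Ioo a b, -py' x + (q x : ℂ) * y x = z * (r x : ℂ) * y x) :
    ∃ v' Pv' : ℝ → ℂ, ∀ x ∈ Set.Ioo a b,
      HasDerivAt (fun t => y t / (uh t : ℂ)) (v' x) x ∧
      HasDerivAt (fun t => ((uh t ^ 2 * p t : ℝ) : ℂ) * v' t) (Pv' x) x ∧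
      -Pv' x + ((uh x * (-(puh' x) + q x * uh x) : ℝ) : ℂ) * (y x / (uh x : ℂ)) =
        z * ((uh x ^ 2 * r x : ℝ) : ℂ) * (y x / (uh x : ℂ)) := by
  refine ⟨fun t => (y' t * (uh t : ℂ) - y t * (uh' t : ℂ)) / (uh t : ℂ) ^ 2,
    fun t => py' t * (uh t : ℂ) - (puh' t : ℂ) * y t, fun x hx => ?_⟩
  have hne : ∀ t ∈ Set.Ioo a b, (uh t : ℂ) ≠ 0 := fun t ht => by
    exact_mod_cast (huhpos t ht).ne'
  have hu := (huh x hx).ofReal_comp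
  have hx0 := hne x hx
  refine ⟨(hy x hx).div hu hx0, ?_, ?_⟩
  · have h1 := (hpy x hx).mul hu
    have h2 := (hpuh x hx).ofReal_comp.mul (hy x hx)
    have h3 := h1.sub h2
    have h4 : HasDerivAt (fun t => (p t : ℂ) * y' t * (uh t : ℂ)
        - ((p t * uh' t : ℝ) : ℂ) * y t) (py' x * (uh x : ℂ) - (puh' x : ℂ) * y x) x := by
      refine h3.congr_deriv ?_
      push_cast
      ring
    refine h4.congr_of_eventuallyEq ?_
    filter_upwards [isOpen_Ioo.mem_nhds hx] with t ht
    have := hne t ht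
    push_cast
    field_simp
  · have h := heq x hx
    push_cast
    field_simp
    linear_combination (uh x : ℂ) * h
end

section
/- Let (a,b) ⊂ ℝ be an interval, let P, Q, R : (a,b) → ℝ, and let z ∈ ℂ. Let v₁, v₂, w : (a,b) → ℂ be such that v₁, P·v₁′, v₂, P·v₂′, w, P·w′ are differentiable on (a,b), and suppose that on (a,b): −(P v₁′)′ + Q v₁ = z R v₁, −(P v₂′)′ + Q v₂ = z R v₂, and −(P w′)′ + Q w = R v₂ + z R w. Then for all x ∈ (a,b): (d/dx)[ v₁(x) P(x) w′(x) − P(x) v₁′(x) w(x) ] = −R(x) v₁(x) v₂(x). -/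
/-- Pointwise identity at the heart of Lemma 3.6 of the paper: if `v₁`, `v₂` solve
`−(P v′)′ + Q v = z R v` and `w` solves the z-differentiated equation
`−(P w′)′ + Q w = R v₂ + z R w` on `(a,b)`, then
`(d/dx)[v₁ (P w′) − (P v₁′) w] = −R v₁ v₂` on `(a,b)`. -/
theorem modified_wronskian_derivative
    (a b : ℝ) (P Q R : ℝ → ℝ) (z : ℂ)
    (v₁ v₂ w v₁' v₂' w' dPv₁ dPv₂ dPw : ℝ → ℂ)
    (hv₁ : ∀ x ∈ Set.Ioo a b, HasDerivAt v₁ (v₁' x) x)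
    (hv₂ : ∀ x ∈ Set.Ioo a b, HasDerivAt v₂ (v₂' x) x)
    (hw : ∀ x ∈ Set.Ioo a b, HasDerivAt w (w' x) x)
    (hdPv₁ : ∀ x ∈ Set.Ioo a b, HasDerivAt (fun t => (P t : ℂ) * v₁' t) (dPv₁ x) x)
    (hdPv₂ : ∀ x ∈ Set.Ioo a b, HasDerivAt (fun t => (P t : ℂ) * v₂' t) (dPv₂ x) x)
    (hdPw : ∀ x ∈ Set.Ioo a b, HasDerivAt (fun t => (P t : ℂ) * w' t) (dPw x) x)
    (heq₁ : ∀ x ∈ Set.Ioo a b, -dPv₁ x + (Q x : ℂ) * v₁ x = z * (R x : ℂ) * v₁ x)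
    (heq₂ : ∀ x ∈ Set.Ioo a b, -dPv₂ x + (Q x : ℂ) * v₂ x = z * (R x : ℂ) * v₂ x)
    (heqw : ∀ x ∈ Set.Ioo a b,
      -dPw x + (Q x : ℂ) * w x = (R x : ℂ) * v₂ x + z * (R x : ℂ) * w x) :
    ∀ x ∈ Set.Ioo a b,
      HasDerivAt (fun t => v₁ t * ((P t : ℂ) * w' t) - ((P t : ℂ) * v₁' t) * w t)
        (-((R x : ℂ) * v₁ x * v₂ x)) x := by
  intro x hx
  have h := ((hv₁ x hx).mul (hdPw x hx)).sub ((hdPv₁ x hx).mul (hw x hx))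
  refine HasDerivAt.congr_deriv h ?_
  linear_combination (-(v₁ x)) * heqw x hx + w x * heq₁ x hx
end

section
/- Let a < b be real numbers, let P, Q, R : [a,b] → ℝ, and let z ∈ ℂ. Let v₁, v₂, w : [a,b] → ℂ be continuous, with P·v₁′ and P·w′ extending continuously to [a,b], such that v₁, P·v₁′, v₂, P·v₂′, w, P·w′ are differentiable on (a,b), R·v₁·v₂ is continuous on [a,b], and suppose that on (a,b): −(P v₁′)′ + Q v₁ = z R v₁, −(P v₂′)′ + Q v₂ = z R v₂, and −(P w′)′ + Q w = R v₂ + z R w. Then ∫_a^b R(x) v₁(x) v₂(x) dx = W(a) − W(b), where W(x) = v₁(x) P(x) w′(x) − P(x) v₁′(x) w(x). -/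
open MeasureTheory intervalIntegral

/-- Integrated form of Lemma 3.6 of the paper: for solutions `v₁`, `v₂` of
`−(P v′)′ + Q v = z R v` on `(a,b)` and `w` a solution of the z-differentiated equation
`−(P w′)′ + Q w = R v₂ + z R w`, with `P v₁′` and `P w′` extending continuously to `[a,b]`
(as `G₁`, `G₃`), one has `∫_a^b R v₁ v₂ dx = W(a) − W(b)` where
`W = v₁ (P w′) − (P v₁′) w`. -/
theorem trace_resolvent_integral_identity
    (a b : ℝ) (hab : a < b) (P Q R : ℝ → ℝ) (z : ℂ)
    (v₁ v₂ w v₁' v₂' w' dPv₁ dPv₂ dPw G₁ G₃ : ℝ → ℂ)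
    (hv₁ : ∀ x ∈ Set.Ioo a b, HasDerivAt v₁ (v₁' x) x)
    (hv₂ : ∀ x ∈ Set.Ioo a b, HasDerivAt v₂ (v₂' x) x)
    (hw : ∀ x ∈ Set.Ioo a b, HasDerivAt w (w' x) x)
    (hG₁ : ∀ x ∈ Set.Ioo a b, G₁ x = (P x : ℂ) * v₁' x)
    (hG₃ : ∀ x ∈ Set.Ioo a b, G₃ x = (P x : ℂ) * w' x)
    (hG₁c : ContinuousOn G₁ (Set.Icc a b))
    (hG₃c : ContinuousOn G₃ (Set.Icc a b))
    (hv₁c : ContinuousOn v₁ (Set.Icc a b))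
    (hv₂c : ContinuousOn v₂ (Set.Icc a b))
    (hwc : ContinuousOn w (Set.Icc a b))
    (hdPv₁ : ∀ x ∈ Set.Ioo a b, HasDerivAt (fun t => (P t : ℂ) * v₁' t) (dPv₁ x) x)
    (hdPv₂ : ∀ x ∈ Set.Ioo a b, HasDerivAt (fun t => (P t : ℂ) * v₂' t) (dPv₂ x) x)
    (hdPw : ∀ x ∈ Set.Ioo a b, HasDerivAt (fun t => (P t : ℂ) * w' t) (dPw x) x)
    (heq₁ : ∀ x ∈ Set.Ioo a b, -dPv₁ x + (Q x : ℂ) * v₁ x = z * (R x : ℂ) * v₁ x)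
    (heq₂ : ∀ x ∈ Set.Ioo a b, -dPv₂ x + (Q x : ℂ) * v₂ x = z * (R x : ℂ) * v₂ x)
    (heqw : ∀ x ∈ Set.Ioo a b,
      -dPw x + (Q x : ℂ) * w x = (R x : ℂ) * v₂ x + z * (R x : ℂ) * w x)
    (hRc : ContinuousOn (fun x => (R x : ℂ) * v₁ x * v₂ x) (Set.Icc a b)) :
    ∫ x in a..b, (R x : ℂ) * v₁ x * v₂ x =
      (v₁ a * G₃ a - G₁ a * w a) - (v₁ b * G₃ b - G₁ b * w b) := by
  have key := integral_eq_sub_of_hasDerivAt_of_le (f := fun x => G₁ x * w x - v₁ x * G₃ x)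
    (f' := fun x => (R x : ℂ) * v₁ x * v₂ x) hab.le
    ((hG₁c.mul hwc).sub (hv₁c.mul hG₃c)) ?_ (hRc.intervalIntegrable_of_Icc hab.le)
  · rw [key]
    ring
  · intro x hx
    have hn := Ioo_mem_nhds hx.1 hx.2
    have h1 : HasDerivAt G₁ (dPv₁ x) x :=
      (hdPv₁ x hx).congr_of_eventuallyEq (Filter.eventually_of_mem hn hG₁)
    have h3 : HasDerivAt G₃ (dPw x) x :=
      (hdPw x hx).congr_of_eventuallyEq (Filter.eventually_of_mem hn hG₃)
    have h := (h1.mul (hw x hx)).sub ((hv₁ x hx).mul h3)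
    refine h.congr_deriv ?_
    rw [hG₁ x hx, hG₃ x hx]
    linear_combination (-w x) * heq₁ x hx + v₁ x * heqw x hx
end

section
/- Let F be a complex-analytic function on a neighborhood of 0 ∈ ℂ, not identically zero, with Taylor expansion F(z) = ∑_{j=0}^∞ a_j z^j, and let m₀ ≥ 0 be the order of the zero of F at 0 (so a_j = 0 for j < m₀ and a_{m₀} ≠ 0). Define (b_j)_{j≥1} by b₁ = a_{1+m₀}/a_{m₀} and b_j = a_{j+m₀}/a_{m₀} − ∑_{ℓ=1}^{j−1} (ℓ/j)(a_{j−ℓ+m₀}/a_{m₀}) b_ℓ for j ≥ 2. Then the function z ↦ z·F′(z)/F(z) extends analytically to a neighborhood of 0, and its Taylor expansion there is m₀ + ∑_{j=1}^∞ j·b_j·z^j. Equivalently, for every n ≥ 1 the residue at z = 0 of z^{−n}(d/dz) ln F(z) equals n·b_n. -/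
theorem aux_congr {f g : ℕ → ℂ} {x : ℂ} (h : ∀ n, f n = g n) : HasSum f x ↔ HasSum g x := by
  rw [funext h]

theorem aux_fps (c : ℕ → ℂ) (f : ℂ → ℂ) (r : ℝ) (hr : 0 < r)
    (h : ∀ z : ℂ, ‖z‖ < r → HasSum (fun j : ℕ => c j * z ^ j) (f z)) :
    HasFPowerSeriesOnBall f (FormalMultilinearSeries.ofScalars ℂ c) 0 (ENNReal.ofReal r) := by
  refine ⟨?_, by simpa using hr, ?_⟩
  · refine ENNReal.le_of_forall_nnreal_lt fun s hs => ?_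
    apply FormalMultilinearSeries.le_radius_of_summable
    have hs' : (s : ℝ) < r := by
      rw [ENNReal.lt_ofReal_iff_toReal_lt (by simp)] at hs
      simpa using hs
    have h1 := (h ((s : ℝ) : ℂ) (by simpa using hs')).summable.norm
    refine h1.congr fun n => ?_
    simp
  · intro y hy
    have hy' : ‖y‖ < r := by
      simpa [Metric.mem_eball, edist_zero_right, ← ofReal_norm, ENNReal.ofReal_lt_ofReal_iff hr] using hy
    have h1 := h y hy'
    rw [zero_add]
    refine (aux_congr fun n => ?_).2 h1
    simp [mul_comm]

theorem aux_unique (c d : ℕ → ℂ) (f : ℂ → ℂ) (r : ℝ) (hr : 0 < r)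
    (h : ∀ z : ℂ, ‖z‖ < r → HasSum (fun j : ℕ => c j * z ^ j) (f z))
    (h' : ∀ z : ℂ, ‖z‖ < r → HasSum (fun j : ℕ => d j * z ^ j) (f z)) : c = d := by
  have h1 := (aux_fps c f r hr h).hasFPowerSeriesAt.eq_formalMultilinearSeries
    (aux_fps d f r hr h').hasFPowerSeriesAt
  funext n
  have := congrArg (fun p => p.coeff n) h1
  simpa using this

theorem aux_taylor (f : ℂ → ℂ) (r : ℝ) (hf : DifferentiableOn ℂ f (Metric.ball 0 r)) :
    ∀ z : ℂ, ‖z‖ < r → HasSum (fun j : ℕ => ((j.factorial : ℂ)⁻¹ * iteratedDeriv j f 0) * z ^ j) (f z) := by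
  intro z hz
  have := Complex.hasSum_taylorSeries_on_ball hf (z := z) (by simpa using hz)
  refine (aux_congr fun n => ?_).2 this
  simp only [smul_eq_mul, sub_zero]
  ring

theorem aux_diff (c : ℕ → ℂ) (f : ℂ → ℂ) (r : ℝ) (hr : 0 < r)
    (h : ∀ z : ℂ, ‖z‖ < r → HasSum (fun j : ℕ => c j * z ^ j) (f z)) :
    DifferentiableOn ℂ f (Metric.ball 0 r) := by
  have := (aux_fps c f r hr h).differentiableOn
  rwa [Metric.eball_ofReal] at this

theorem aux_zderiv (c : ℕ → ℂ) (f : ℂ → ℂ) (r : ℝ) (hr : 0 < r)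
    (h : ∀ z : ℂ, ‖z‖ < r → HasSum (fun j : ℕ => c j * z ^ j) (f z)) :
    ∀ z : ℂ, ‖z‖ < r → HasSum (fun j : ℕ => ((j : ℂ) * c j) * z ^ j) (z * deriv f z) := by
  intro z hz
  have hd := aux_diff c f r hr h
  have h1 := aux_unique _ _ f r hr h (aux_taylor f r hd)
  have h2 := (aux_taylor (deriv f) r (hd.deriv Metric.isOpen_ball) z hz).mul_left z
  rw [← hasSum_nat_add_iff' 1]
  simp only [Finset.range_one, Finset.sum_singleton, Nat.cast_zero, zero_mul, sub_zero]
  refine (aux_congr fun n => ?_).2 h2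
  rw [h1]
  beta_reduce
  rw [iteratedDeriv_succ', Nat.factorial_succ]
  have : ((n : ℂ) + 1) ≠ 0 := by exact_mod_cast n.succ_ne_zero
  have : ((n.factorial : ℂ)) ≠ 0 := by exact_mod_cast n.factorial_ne_zero
  push_cast
  field_simp
  ring

theorem aux_mul (c d e : ℕ → ℂ) (f g : ℂ → ℂ) (r : ℝ) (hr : 0 < r)
    (hf : ∀ z : ℂ, ‖z‖ < r → HasSum (fun j : ℕ => c j * z ^ j) (f z))
    (hg : ∀ z : ℂ, ‖z‖ < r → HasSum (fun j : ℕ => d j * z ^ j) (g z))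
    (he : ∀ z : ℂ, ‖z‖ < r → HasSum (fun j : ℕ => e j * z ^ j) (f z * g z)) (n : ℕ) :
    e n = ∑ l ∈ Finset.range (n + 1), d l * c (n - l) := by
  have : e = fun n => ∑ l ∈ Finset.range (n + 1), d l * c (n - l) := by
    refine aux_unique _ _ _ r hr he fun z hz => ?_
    have h := hasSum_sum_range_mul_of_summable_norm (hg z hz).summable.norm (hf z hz).summable.norm
    rw [(hg z hz).tsum_eq, (hf z hz).tsum_eq, mul_comm] at h
    refine (aux_congr fun m => ?_).2 h
    rw [Finset.sum_mul]
    refine Finset.sum_congr rfl fun l hl => ?_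
    have : l + (m - l) = m := by have := Finset.mem_range.1 hl; omega
    nth_rewrite 2 [← this]
    rw [pow_add]; ring
  exact congrFun this n

/-- Analytic core of Theorem 4.1 of the paper: let `F(z) = ∑_j a_j z^j` on a ball of
radius `r > 0`, with a zero of exact order `m₀` at `0`. Define `b₁ = a_{1+m₀}/a_{m₀}` and
`b_j = a_{j+m₀}/a_{m₀} − ∑_{ℓ=1}^{j−1} (ℓ/j)(a_{j−ℓ+m₀}/a_{m₀}) b_ℓ`. Then
`z F′(z)/F(z)` extends analytically to a neighborhood of `0` with Taylor expansion
`m₀ + ∑_{j≥1} j b_j z^j`. -/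
theorem log_derivative_taylor_coefficients
    (F : ℂ → ℂ) (a : ℕ → ℂ) (r : ℝ) (hr : 0 < r)
    (hF : ∀ z : ℂ, ‖z‖ < r → HasSum (fun j : ℕ => a j * z ^ j) (F z))
    (m₀ : ℕ) (hvanish : ∀ j < m₀, a j = 0) (hne : a m₀ ≠ 0)
    (b : ℕ → ℂ)
    (hb1 : b 1 = a (1 + m₀) / a m₀)
    (hbj : ∀ j, 2 ≤ j → b j = a (j + m₀) / a m₀ -
      ∑ ℓ ∈ Finset.Ico 1 j, ((ℓ : ℂ) / (j : ℂ)) * (a (j - ℓ + m₀) / a m₀) * b ℓ) :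
    ∃ G : ℂ → ℂ, ∃ r' > (0 : ℝ),
      AnalyticOnNhd ℂ G (Metric.ball (0 : ℂ) r') ∧
      (∀ z : ℂ, ‖z‖ < r' → z ≠ 0 → F z ≠ 0 ∧ G z = z * deriv F z / F z) ∧
      (∀ z : ℂ, ‖z‖ < r' →
        HasSum (fun j : ℕ => ((j + 1 : ℕ) : ℂ) * b (j + 1) * z ^ (j + 1)) (G z - (m₀ : ℂ))) := by
  set c : ℕ → ℂ := fun j => a (j + m₀) with hc
  have hc0 : c 0 = a m₀ := by simp [hc]
  -- shifted series
  have hsh : ∀ z : ℂ, ‖z‖ < r → HasSum (fun j : ℕ => z ^ m₀ * (c j * z ^ j)) (F z) := by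
    intro z hz
    have h := (hasSum_nat_add_iff' m₀).2 (hF z hz)
    rw [Finset.sum_eq_zero (fun i hi => by rw [hvanish i (Finset.mem_range.1 hi), zero_mul]),
      sub_zero] at h
    refine (aux_congr fun j => ?_).2 h
    simp only [hc, pow_add]; ring
  obtain ⟨H, hH⟩ : ∃ H : ℂ → ℂ, ∀ z : ℂ, ‖z‖ < r → HasSum (fun j : ℕ => c j * z ^ j) (H z) := by
    refine ⟨fun z => ∑' j, c j * z ^ j, fun z hz => ?_⟩
    by_cases h0 : z = 0
    · subst h0
      refine (summable_of_ne_finset_zero (s := {0}) fun j hj => ?_).hasSum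
      simp at hj
      simp [hj]
    · exact ((summable_mul_left_iff (pow_ne_zero m₀ h0)).1 (hsh z hz).summable).hasSum
  have hFH : ∀ z : ℂ, ‖z‖ < r → F z = z ^ m₀ * H z := fun z hz =>
    (hsh z hz).unique ((hH z hz).mul_left _)
  have hH0 : H 0 = a m₀ := by
    rw [← hc0]
    refine (hH 0 (by simpa using hr)).unique ?_
    convert hasSum_single (f := fun j : ℕ => c j * (0 : ℂ) ^ j) 0 ?_ using 1
    · simp
    · intro j hj; simp [hj]
  have hHd := aux_diff c H r hr hH
  have hHc : ContinuousAt H 0 :=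
    (hHd.differentiableAt (Metric.ball_mem_nhds 0 hr)).continuousAt
  obtain ⟨ε, hε, hHε⟩ := Metric.eventually_nhds_iff.1 (hHc.eventually_ne (hH0 ▸ hne))
  set s := min ε r with hs
  have hs0 : 0 < s := lt_min hε hr
  have hsr : ∀ z : ℂ, ‖z‖ < s → ‖z‖ < r := fun z hz => hz.trans_le (min_le_right _ _)
  have hHne : ∀ z : ℂ, ‖z‖ < s → H z ≠ 0 := fun z hz =>
    hHε (by simpa using hz.trans_le (min_le_left _ _))
  have hsub : Metric.ball (0 : ℂ) s ⊆ Metric.ball 0 r := Metric.ball_subset_ball (min_le_right _ _)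
  have hKd : DifferentiableOn ℂ (fun z => z * deriv H z / H z) (Metric.ball 0 s) := by
    refine DifferentiableOn.div (differentiableOn_id.mul ?_) (hHd.mono hsub) ?_
    · exact (hHd.deriv Metric.isOpen_ball).mono hsub
    · intro z hz; exact hHne z (by simpa using hz)
  obtain ⟨k, hk⟩ : ∃ k : ℕ → ℂ, ∀ z : ℂ, ‖z‖ < s →
      HasSum (fun j : ℕ => k j * z ^ j) (z * deriv H z / H z) := ⟨_, aux_taylor _ s hKd⟩
  have hrec := aux_mul c k (fun j => (j : ℂ) * c j) H _ s hs0 (fun z hz => hH z (hsr z hz)) hk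
    (fun z hz => by
      rw [mul_div_cancel₀ _ (hHne z hz)]
      exact aux_zderiv c H r hr hH z (hsr z hz))
  have hk0 : k 0 = 0 := by
    have := hrec 0
    simpa [hc0, hne] using this
  have hbj' : ∀ j, 1 ≤ j → b j = a (j + m₀) / a m₀ -
      ∑ ℓ ∈ Finset.Ico 1 j, ((ℓ : ℂ) / (j : ℂ)) * (a (j - ℓ + m₀) / a m₀) * b ℓ := by
    intro j hj
    rcases hj.eq_or_lt with rfl | hj
    · simpa using hb1
    · exact hbj j hj
  have hkb : ∀ j, 1 ≤ j → k j = j * b j := by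
    intro j
    induction j using Nat.strong_induction_on with
    | _ j ih =>
      intro hj
      have h := hrec j
      have hj0 : (j : ℂ) ≠ 0 := by exact_mod_cast (by omega : j ≠ 0)
      rw [Finset.sum_range_succ, Finset.range_eq_Ico, Finset.sum_eq_sum_Ico_succ_bot hj, hk0,
        Nat.sub_self, hc0, zero_mul, zero_add, zero_add] at h
      have h2 : ∑ l ∈ Finset.Ico 1 j, k l * c (j - l) =
          (j * a m₀) * ∑ ℓ ∈ Finset.Ico 1 j, ((ℓ : ℂ) / (j : ℂ)) * (a (j - ℓ + m₀) / a m₀) * b ℓ := by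
        rw [Finset.mul_sum]
        refine Finset.sum_congr rfl fun l hl => ?_
        obtain ⟨hl1, hl2⟩ := Finset.mem_Ico.1 hl
        rw [ih l hl2 hl1]
        simp only [hc]
        field_simp
      rw [h2] at h
      rw [hbj' j hj]
      simp only [hc] at h
      have h3 : k j = (j * a (j + m₀) - (j * a m₀) *
        ∑ ℓ ∈ Finset.Ico 1 j, ((ℓ : ℂ) / (j : ℂ)) * (a (j - ℓ + m₀) / a m₀) * b ℓ) / a m₀ := by
        rw [eq_div_iff hne, h]; ring
      rw [h3, sub_div, mul_sub, mul_div_assoc, mul_right_comm, mul_div_cancel_right₀ _ hne]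
  refine ⟨fun z => m₀ + z * deriv H z / H z, s, hs0, ?_, ?_, ?_⟩
  · exact ((differentiableOn_const _).add hKd).analyticOnNhd Metric.isOpen_ball
  · intro z hz hz0
    have hFz := hFH z (hsr z hz)
    have hHz := hHne z hz
    refine ⟨by rw [hFz]; exact mul_ne_zero (pow_ne_zero _ hz0) hHz, ?_⟩
    have hmem : Metric.ball (0 : ℂ) r ∈ nhds z :=
      Metric.isOpen_ball.mem_nhds (by simpa using hsr z hz)
    have hev : F =ᶠ[nhds z] fun w => w ^ m₀ * H w := by
      filter_upwards [hmem] with w hw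
      exact hFH w (by simpa using hw)
    have hder := (hasDerivAt_pow m₀ z).mul (hHd.differentiableAt hmem).hasDerivAt
    have hd : deriv F z = (m₀ : ℂ) * z ^ (m₀ - 1) * H z + z ^ m₀ * deriv H z := by
      rw [hev.deriv_eq]; exact hder.deriv
    have hp : (m₀ : ℂ) * z ^ (m₀ - 1) * z = m₀ * z ^ m₀ := by
      rcases m₀ with _ | m
      · simp
      · simp [pow_succ, mul_assoc]
    have hzm : z ^ m₀ ≠ 0 := pow_ne_zero _ hz0
    rw [eq_div_iff (by rw [hFz]; exact mul_ne_zero hzm hHz), hd, hFz]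
    have e : (m₀ + z * deriv H z / H z) * (z ^ m₀ * H z) =
        m₀ * z ^ m₀ * H z + z * deriv H z * z ^ m₀ := by field_simp
    rw [e, ← hp]; ring
  · intro z hz
    have h := (hasSum_nat_add_iff' 1).2 (hk z hz)
    simp only [Finset.range_one, Finset.sum_singleton, hk0, zero_mul, sub_zero] at h
    rw [add_sub_cancel_left]
    refine (aux_congr fun j => ?_).2 h
    rw [hkb (j + 1) (by omega)]
end

section
/- Let a < b be real numbers, μ ∈ (0,1), z ∈ ℂ, and set B = 2(b−a)^{(1−μ)/2}/(1−μ). Suppose y : (a,b) → ℂ is such that y and x ↦ (x−a)^{(3−μ)/2} y′(x) are differentiable on (a,b) and y satisfies −( (x−a)^{(3−μ)/2} y′(x) )′ = z (x−a)^{(1−3μ)/2} y(x) for all x ∈ (a,b). Define u : (0,B) → ℂ by u(t) = (x(t) − a)^{(1−μ)/2} · y(x(t)), where x(t) = a + ((1−μ)t/2)^{2/(1−μ)}. Then u is twice differentiable on (0,B) and −u″(t) = z·u(t) for all t ∈ (0,B). -/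
/-- Example 4.5 of the paper: the quasi-regular problem
`−((x−a)^{(3−μ)/2} y′)′ = z (x−a)^{(1−3μ)/2} y` on `(a,b)`, `μ ∈ (0,1)`, is transformed
by the Liouville change of variables `x(t) = a + ((1−μ)t/2)^{2/(1−μ)}`,
`u(t) = (x(t)−a)^{(1−μ)/2} y(x(t))`, into the free Schrödinger equation `−u″ = z u` on
`(0,B)` with `B = 2(b−a)^{(1−μ)/2}/(1−μ)`. -/
theorem liouville_transform_free_schroedinger
    (a b μ : ℝ) (hab : a < b) (hμ : μ ∈ Set.Ioo (0 : ℝ) 1) (z : ℂ)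
    (y y' g : ℝ → ℂ)
    (hy : ∀ x ∈ Set.Ioo a b, HasDerivAt y (y' x) x)
    (hg : ∀ x ∈ Set.Ioo a b,
      HasDerivAt (fun s => (((s - a) ^ ((3 - μ) / 2) : ℝ) : ℂ) * y' s) (g x) x)
    (heq : ∀ x ∈ Set.Ioo a b,
      -g x = z * (((x - a) ^ ((1 - 3 * μ) / 2) : ℝ) : ℂ) * y x) :
    ∃ u' u'' : ℝ → ℂ, ∀ t ∈ Set.Ioo 0 (2 * (b - a) ^ ((1 - μ) / 2) / (1 - μ)),
      HasDerivAt
        (fun s : ℝ => ((((a + ((1 - μ) * s / 2) ^ (2 / (1 - μ))) - a) ^ ((1 - μ) / 2) : ℝ) : ℂ) *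
          y (a + ((1 - μ) * s / 2) ^ (2 / (1 - μ)))) (u' t) t ∧
      HasDerivAt u' (u'' t) t ∧
      -u'' t = z * (((((a + ((1 - μ) * t / 2) ^ (2 / (1 - μ))) - a) ^ ((1 - μ) / 2) : ℝ) : ℂ) *
          y (a + ((1 - μ) * t / 2) ^ (2 / (1 - μ)))) := by
  obtain ⟨h0, h1⟩ := hμ
  obtain ⟨c, hc⟩ : ∃ c, c = (1 - μ) / 2 := ⟨_, rfl⟩
  have hcpos : 0 < c := by rw [hc]; linarith
  obtain ⟨d, hd⟩ : ∃ d, d = 2 / (1 - μ) := ⟨_, rfl⟩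
  have hcd : c * d = 1 := by
    rw [hc, hd]
    have : (1 - μ) ≠ 0 := by linarith
    field_simp
  have hdc : d * c = 1 := by rw [mul_comm, hcd]
  have e1 : (3 - μ) / 2 = 1 + c := by rw [hc]; ring
  have e2 : (1 - 3 * μ) / 2 = 3 * c - 1 := by rw [hc]; ring
  have e3 : ∀ s : ℝ, (1 - μ) * s / 2 = c * s := by intro s; rw [hc]; ring
  have e4 : 2 * (b - a) ^ c / (1 - μ) = d * (b - a) ^ c := by
    rw [hd]; ring
  simp only [e3, e4, ← hc, ← hd, add_sub_cancel_left]
  simp only [e1] at hg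
  simp only [e2] at heq
  clear e1 e2 e3 e4
  have hx : ∀ t ∈ Set.Ioo 0 (d * (b - a) ^ c), a + (c * t) ^ d ∈ Set.Ioo a b := by
    rintro t ⟨ht0, ht1⟩
    have hw : 0 < c * t := mul_pos hcpos ht0
    have hba : 0 < b - a := by linarith
    have hdpos : 0 < d := by
      by_contra h
      nlinarith
    have h2 : c * t < (b - a) ^ c := by
      calc c * t < c * (d * (b - a) ^ c) := by gcongr
        _ = (b - a) ^ c := by rw [← mul_assoc, hcd, one_mul]
    have h3 := Real.rpow_lt_rpow hw.le h2 hdpos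
    rw [← Real.rpow_mul hba.le, hcd, Real.rpow_one] at h3
    have h4 := Real.rpow_pos_of_pos hw d
    constructor <;> linarith
  have hxd : ∀ t : ℝ, 0 < t → HasDerivAt (fun s : ℝ => a + (c * s) ^ d) ((c * t) ^ (d - 1)) t := by
    intro t ht
    have hw : 0 < c * t := mul_pos hcpos ht
    have h := (((hasDerivAt_id t).const_mul c).rpow_const (p := d) (Or.inl hw.ne')).const_add a
    refine HasDerivAt.congr_deriv h ?_
    simp only [id, mul_one, hcd, one_mul]
  refine ⟨fun s => (c : ℂ) * y (a + (c * s) ^ d) + (((c * s)⁻¹ : ℝ) : ℂ) *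
    ((((a + (c * s) ^ d - a) ^ (1 + c) : ℝ) : ℂ) * y' (a + (c * s) ^ d)),
    fun s => -(z * ((((c * s) ^ d) ^ c : ℝ) * y (a + (c * s) ^ d))), ?_⟩
  intro t ht
  have hw : 0 < c * t := mul_pos hcpos ht.1
  have hX := hx t ht
  have hY : HasDerivAt (fun s : ℝ => y (a + (c * s) ^ d))
      (((c * t) ^ (d - 1) : ℝ) • y' (a + (c * t) ^ d)) t :=
    HasDerivAt.scomp t (hy _ hX) (hxd t ht.1)
  have hP := HasDerivAt.scomp (h := fun s : ℝ => a + (c * s) ^ d) t (hg _ hX) (hxd t ht.1)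
  have hlin : HasDerivAt (fun s : ℝ => c * s) c t := by
    simpa using (hasDerivAt_id t).const_mul c
  have r1 : ((c * t) ^ d) ^ c = c * t := by
    rw [← Real.rpow_mul hw.le, hdc, Real.rpow_one]
  have r2 : ((c * t) ^ d) ^ (1 + c) = (c * t) * (c * t) * (c * t) ^ (d - 1) := by
    rw [← Real.rpow_mul hw.le, Real.rpow_sub_one hw.ne', mul_add, hdc, Real.rpow_add hw]
    simp only [mul_one, Real.rpow_one]
    field_simp
  have r3 : ((c * t) ^ d) ^ (3 * c - 1) * (c * t) ^ (d - 1) = (c * t) * (c * t) := by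
    rw [← Real.rpow_mul hw.le, ← Real.rpow_add hw,
      show d * (3 * c - 1) + (d - 1) = 2 by linear_combination 3 * hdc, Real.rpow_two, sq]
  refine ⟨?_, ?_, by simp⟩
  · have h := hlin.ofReal_comp.mul hY
    have h' := h.congr_of_eventuallyEq (f₁ := fun s : ℝ => ((((c * s) ^ d) ^ c : ℝ) : ℂ) *
      y (a + (c * s) ^ d)) (by
        filter_upwards [lt_mem_nhds ht.1] with s hs
        have hws : 0 < c * s := mul_pos hcpos hs
        simp only [Pi.mul_apply]
        rw [← Real.rpow_mul hws.le, hdc, Real.rpow_one])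
    refine HasDerivAt.congr_deriv h' ?_
    simp only [add_sub_cancel_left, r2, Complex.real_smul]
    have hwc : ((c * t : ℝ) : ℂ) ≠ 0 := by exact_mod_cast hw.ne'
    generalize c * t = w at *
    push_cast
    field_simp
  · have hinv := (hlin.inv hw.ne').ofReal_comp
    have h := (hY.const_mul (c : ℂ)).add (hinv.mul hP)
    refine HasDerivAt.congr_deriv h ?_
    have hgx : g (a + (c * t) ^ d) =
        -(z * (((a + (c * t) ^ d - a) ^ (3 * c - 1) : ℝ) : ℂ) * y (a + (c * t) ^ d)) := by
      rw [← heq _ hX, neg_neg]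
    have r3c : ((((c * t) ^ d) ^ (3 * c - 1) : ℝ) : ℂ) * (((c * t) ^ (d - 1) : ℝ) : ℂ) =
      ((c * t : ℝ) : ℂ) * ((c * t : ℝ) : ℂ) := by exact_mod_cast r3
    have hwc : ((c * t : ℝ) : ℂ) ≠ 0 := by exact_mod_cast hw.ne'
    simp only [Function.comp, Pi.inv_apply, hgx, add_sub_cancel_left, r1, r2, Complex.real_smul]
    generalize (((c * t) ^ d) ^ (3 * c - 1)) = A at *
    generalize ((c * t) ^ (d - 1)) = D at *
    generalize y (a + (c * t) ^ d) = Y at *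
    generalize y' (a + (c * t) ^ d) = Y' at *
    generalize c * t = w at *
    rw [Complex.ofReal_inv, Complex.ofReal_div, Complex.ofReal_neg, Complex.ofReal_pow,
      Complex.ofReal_mul, Complex.ofReal_mul]
    field_simp
    linear_combination -(z * Y) * r3c
end

section
/- For every z ∈ ℂ, sin( (π/2)(√(1+4z) − 1) ) = 0 (principal branch of the square root) if and only if there exists n ∈ ℕ₀ = {0,1,2,...} with z = n(n+1). -/
/-- Zero set of the characteristic function of the Friedrichs extension of the Legendre
operator: for every `z ∈ ℂ`, `sin((π/2)(√(1+4z) − 1)) = 0` (principal branch of the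
square root) if and only if `z = n(n+1)` for some `n ∈ ℕ₀`. -/
theorem legendre_spectrum (z : ℂ) :
    Complex.sin (((Real.pi : ℂ) / 2) * ((1 + 4 * z) ^ ((1 : ℂ) / 2) - 1)) = 0 ↔
      ∃ n : ℕ, z = (n : ℂ) * ((n : ℂ) + 1) := by
  have hw : ((1 + 4 * z) ^ ((1 : ℂ) / 2)) ^ 2 = 1 + 4 * z := by
    have h := Complex.cpow_nat_inv_pow (1 + 4 * z) (n := 2) (by norm_num)
    simpa using h
  generalize (1 + 4 * z) ^ ((1 : ℂ) / 2) = w at hw ⊢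
  have hpi : (Real.pi : ℂ) ≠ 0 := by exact_mod_cast Real.pi_ne_zero
  rw [Complex.sin_eq_zero_iff]
  constructor
  · rintro ⟨k, hk⟩
    have hk2 : w = 2 * k + 1 := by
      have : (Real.pi : ℂ) * (w - 1 - 2 * k) = 0 := by linear_combination 2 * hk
      rcases mul_eq_zero.mp this with h | h
      · exact absurd h hpi
      · linear_combination h
    have hz : z = (k : ℂ) * (k + 1) := by
      rw [hk2] at hw
      linear_combination (-1 / 4) * hw
    rcases le_or_gt 0 k with h | h
    · obtain ⟨n, rfl⟩ := Int.eq_ofNat_of_zero_le h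
      exact ⟨n, by simpa using hz⟩
    · obtain ⟨n, hn⟩ := Int.eq_ofNat_of_zero_le (show 0 ≤ -k - 1 by omega)
      have hk' : k = -(n : ℤ) - 1 := by omega
      refine ⟨n, ?_⟩
      rw [hz, hk']
      push_cast
      ring
  · rintro ⟨n, rfl⟩
    have h : (w - (2 * n + 1)) * (w + (2 * n + 1)) = 0 := by linear_combination hw
    rcases mul_eq_zero.mp h with h | h
    · refine ⟨n, ?_⟩
      push_cast
      linear_combination (Real.pi : ℂ) / 2 * h
    · refine ⟨-(n : ℤ) - 1, ?_⟩
      push_cast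
      linear_combination (Real.pi : ℂ) / 2 * h
end

section
/- Let a < x₁ be real numbers and let p, û, u : (a,x₁) → ℝ and v : (a,x₁) → ℂ be differentiable on (a,x₁). Assume: p(x) > 0 and û(x) > 0 for all x ∈ (a,x₁); p(x)( û(x) u′(x) − û′(x) u(x) ) = 1 for all x ∈ (a,x₁); lim_{x↓a} u(x)/û(x) = 0; the limit L := lim_{x↓a} v(x) exists in ℂ; and the limit M := lim_{x↓a} û(x)² p(x) v′(x) exists in ℂ. Then lim_{x↓a} ( v(x) − L ) / ( u(x)/û(x) ) = M. -/
open Filter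

/-- L'Hôpital-type computation proving Lemma 3.3 of the paper: with `û` nonprincipal and
`u` principal at `a`, normalized by `p(û u′ − û′ u) = 1`, if `u/û → 0`, `v → L` and
`û² p v′ → M` as `x ↓ a`, then `(v − L)/(u/û) → M` as `x ↓ a`. -/
theorem generalized_boundary_value_lhopital
    (a x₁ : ℝ) (hax : a < x₁)
    (p uh u : ℝ → ℝ) (uh' u' : ℝ → ℝ) (v v' : ℝ → ℂ) (L M : ℂ)
    (hp : ∀ x ∈ Set.Ioo a x₁, DifferentiableAt ℝ p x)
    (huh : ∀ x ∈ Set.Ioo a x₁, HasDerivAt uh (uh' x) x)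
    (hu : ∀ x ∈ Set.Ioo a x₁, HasDerivAt u (u' x) x)
    (hv : ∀ x ∈ Set.Ioo a x₁, HasDerivAt v (v' x) x)
    (hppos : ∀ x ∈ Set.Ioo a x₁, 0 < p x)
    (huhpos : ∀ x ∈ Set.Ioo a x₁, 0 < uh x)
    (hW : ∀ x ∈ Set.Ioo a x₁, p x * (uh x * u' x - uh' x * u x) = 1)
    (hprin : Tendsto (fun x => u x / uh x) (nhdsWithin a (Set.Ioi a)) (nhds 0))
    (hL : Tendsto v (nhdsWithin a (Set.Ioi a)) (nhds L))
    (hM : Tendsto (fun x => ((uh x ^ 2 * p x : ℝ) : ℂ) * v' x)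
      (nhdsWithin a (Set.Ioi a)) (nhds M)) :
    Tendsto (fun x => (v x - L) / ((u x / uh x : ℝ) : ℂ))
      (nhdsWithin a (Set.Ioi a)) (nhds M) := by
  have key : ∀ φ : ℂ →L[ℝ] ℝ, Tendsto (fun x => φ (v x - L) / (u x / uh x))
      (nhdsWithin a (Set.Ioi a)) (nhds (φ M)) := by
    intro φ
    refine HasDerivAt.lhopital_zero_right_on_Ioo (f' := fun x => φ (v' x))
      (g' := fun x => (u' x * uh x - u x * uh' x) / uh x ^ 2) hax ?_ ?_ ?_ ?_ hprin ?_
    · intro x hx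
      exact φ.hasFDerivAt.comp_hasDerivAt x ((hv x hx).sub_const L)
    · intro x hx
      exact (hu x hx).div (huh x hx) (huhpos x hx).ne'
    · intro x hx
      have h1 := hW x hx
      refine div_ne_zero ?_ (pow_ne_zero _ (huhpos x hx).ne')
      intro h0
      have h2 : uh x * u' x - uh' x * u x = 0 := by linarith
      rw [h2] at h1
      simp at h1
    · have h := (φ.continuous.tendsto (L - L)).comp (hL.sub_const L)
      simpa [Function.comp_def] using h
    · have h := (φ.continuous.tendsto M).comp hM
      refine h.congr' ?_
      filter_upwards [Ioo_mem_nhdsGT hax] with x hx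
      have h1 := hW x hx
      have hpx := (hppos x hx).ne'
      have hux := (huhpos x hx).ne'
      have h2 : u' x * uh x - u x * uh' x = (p x)⁻¹ := by
        apply eq_inv_of_mul_eq_one_left
        linarith
      simp only [Function.comp_apply]
      rw [h2, ← Complex.real_smul, map_smul, smul_eq_mul]
      field_simp
  have hre := key Complex.reCLM
  have him := key Complex.imCLM
  have hc := ((Complex.continuous_ofReal.tendsto _).comp hre).add
    (((Complex.continuous_ofReal.tendsto _).comp him).mul_const Complex.I)
  have e : ((Complex.reCLM M : ℝ) : ℂ) + ((Complex.imCLM M : ℝ) : ℂ) * Complex.I = M :=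
    Complex.re_add_im M
  rw [e] at hc
  refine hc.congr fun x => ?_
  have e2 : ((Complex.reCLM (v x - L) : ℝ) : ℂ) + ((Complex.imCLM (v x - L) : ℝ) : ℂ) * Complex.I
      = v x - L := Complex.re_add_im (v x - L)
  rw [← e2]
  simp only [Function.comp_apply, Complex.ofReal_div _ (u x / uh x)]
  rw [e2, div_mul_eq_mul_div, ← add_div, e2]
end
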